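/- Let p > 2 and let q = p/(p−1) be the Hölder conjugate of p. There exists a constant C > 0 such that for every smooth compactly supported f: ℝ³ → ℝ, ∫ |x|^q N^{p−q} |f|^q dμ ≤ C ( ∫ |∇_ℍ f|^q dμ + ∫ |f|^q dμ ), where |∇_ℍ f|^q = ((X₁f)² + (X₂f)²)^{q/2}. -/

import Mathlib

open MeasureTheory

/-- Horizontal vector field `X₁ = ∂_{x₁} - (x₂/2) ∂_t` on the Heisenberg group `ℝ³`. -/
noncomputable def X1 (f : ℝ × ℝ × ℝ → ℝ) (w : ℝ × ℝ × ℝ) : ℝ :=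
  fderiv ℝ f w (1, 0, -(w.2.1) / 2)

/-- Horizontal vector field `X₂ = ∂_{x₂} + (x₁/2) ∂_t` on the Heisenberg group `ℝ³`. -/
noncomputable def X2 (f : ℝ × ℝ × ℝ → ℝ) (w : ℝ × ℝ × ℝ) : ℝ :=
  fderiv ℝ f w (0, 1, w.1 / 2)

/-- The Kaplan norm `N(x₁,x₂,t) = ((x₁² + x₂²)² + 16 t²)^{1/4}` on the Heisenberg group. -/
noncomputable def KaplanH (w : ℝ × ℝ × ℝ) : ℝ :=
  ((w.1 ^ 2 + w.2.1 ^ 2) ^ 2 + 16 * w.2.2 ^ 2) ^ ((1 : ℝ) / 4)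

/-- The probability measure `dμ = Z⁻¹ e^{-N^p} dξ` on the Heisenberg group `ℝ³`. -/
noncomputable def muH (p : ℝ) : Measure (ℝ × ℝ × ℝ) :=
  volume.withDensity (fun w => ENNReal.ofReal
    ((∫ v : ℝ × ℝ × ℝ, Real.exp (-(KaplanH v) ^ p))⁻¹ * Real.exp (-(KaplanH w) ^ p)))

open Real

/-- The line `s ↦ w + s • v` carries the directional derivative. -/
lemma DifferentiableAt.fderiv_apply_eq_of_hasDerivAt {E : Type*} [NormedAddCommGroup E]
    [NormedSpace ℝ E] {h : E → ℝ} {w v : E} {d : ℝ} (hh : DifferentiableAt ℝ h w)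
    (hd : HasDerivAt (fun s : ℝ => h (w + s • v)) d 0) : fderiv ℝ h w v = d :=
  (hh.hasFDerivAt.hasLineDerivAt v).lineDeriv.symm.trans (HasLineDerivAt.lineDeriv hd)

/-- `|x|²`. -/
def hor (w : ℝ × ℝ × ℝ) : ℝ := w.1 ^ 2 + w.2.1 ^ 2

/-- `N⁴`. -/
def gauge4 (w : ℝ × ℝ × ℝ) : ℝ := hor w ^ 2 + 16 * w.2.2 ^ 2

/-- First component of `N³ ∇_ℍ N`. -/
def gaugeGrad1 (w : ℝ × ℝ × ℝ) : ℝ := hor w * w.1 - 4 * w.2.1 * w.2.2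

/-- Second component of `N³ ∇_ℍ N`. -/
def gaugeGrad2 (w : ℝ × ℝ × ℝ) : ℝ := hor w * w.2.1 + 4 * w.1 * w.2.2

/-- Regularisation of `|x|^{q-2} N^{-q} e^{-N^p}`, whose product with `N³ ∇_ℍ N` is a constant
multiple of `|∇_ℍ N^p|^{q-2} ∇_ℍ N^p e^{-N^p}`. -/
noncomputable def regWeight (p q ε : ℝ) (w : ℝ × ℝ × ℝ) : ℝ :=
  (hor w + ε) ^ ((q - 2) / 2) * (gauge4 w + ε) ^ (-q / 4) * exp (-(gauge4 w + ε) ^ (p / 4))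

lemma hor_nonneg (w) : 0 ≤ hor w := by unfold hor; positivity
lemma gauge4_nonneg (w) : 0 ≤ gauge4 w := by unfold gauge4; positivity

lemma contDiff_hor {n} : ContDiff ℝ n hor := by unfold hor; fun_prop
lemma contDiff_gauge4 {n} : ContDiff ℝ n gauge4 := by
  unfold gauge4; have := contDiff_hor (n := n); fun_prop
lemma contDiff_gaugeGrad1 {n} : ContDiff ℝ n gaugeGrad1 := by
  unfold gaugeGrad1; have := contDiff_hor (n := n); fun_prop
lemma contDiff_gaugeGrad2 {n} : ContDiff ℝ n gaugeGrad2 := by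
  unfold gaugeGrad2; have := contDiff_hor (n := n); fun_prop

lemma contDiff_regWeight {n} (p q : ℝ) {ε : ℝ} (hε : 0 < ε) : ContDiff ℝ n (regWeight p q ε) := by
  have h1 := contDiff_hor (n := n)
  have h2 := contDiff_gauge4 (n := n)
  have h3 : ContDiff ℝ n fun w => hor w + ε := by fun_prop
  have h4 : ContDiff ℝ n fun w => gauge4 w + ε := by fun_prop
  have h3' (w) : hor w + ε ≠ 0 := by have := hor_nonneg w; positivity
  have h4' (w) : gauge4 w + ε ≠ 0 := by have := gauge4_nonneg w; positivity
  exact ((h3.rpow_const_of_ne h3').mul (h4.rpow_const_of_ne h4')).mul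
    (h4.rpow_const_of_ne h4').neg.exp

lemma hasDerivAt_fst_line (w v : ℝ × ℝ × ℝ) :
    HasDerivAt (fun s : ℝ => (w + s • v).1) v.1 0 := by
  simpa using ((hasDerivAt_id (0:ℝ)).mul_const v.1).const_add w.1

lemma hasDerivAt_snd_fst_line (w v : ℝ × ℝ × ℝ) :
    HasDerivAt (fun s : ℝ => (w + s • v).2.1) v.2.1 0 := by
  simpa using ((hasDerivAt_id (0:ℝ)).mul_const v.2.1).const_add w.2.1

lemma hasDerivAt_snd_snd_line (w v : ℝ × ℝ × ℝ) :
    HasDerivAt (fun s : ℝ => (w + s • v).2.2) v.2.2 0 := by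
  simpa using ((hasDerivAt_id (0:ℝ)).mul_const v.2.2).const_add w.2.2

lemma hasDerivAt_hor_line (w v : ℝ × ℝ × ℝ) :
    HasDerivAt (fun s : ℝ => hor (w + s • v)) (2 * (w.1 * v.1 + w.2.1 * v.2.1)) 0 := by
  refine HasDerivAt.congr_deriv (((hasDerivAt_fst_line w v).fun_pow 2).fun_add
    ((hasDerivAt_snd_fst_line w v).fun_pow 2)) ?_
  simp
  ring

lemma hasDerivAt_gauge4_line (w v : ℝ × ℝ × ℝ) :
    HasDerivAt (fun s : ℝ => gauge4 (w + s • v))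
      (4 * hor w * (w.1 * v.1 + w.2.1 * v.2.1) + 32 * w.2.2 * v.2.2) 0 := by
  refine HasDerivAt.congr_deriv (((hasDerivAt_hor_line w v).fun_pow 2).fun_add
    (((hasDerivAt_snd_snd_line w v).fun_pow 2).const_mul 16)) ?_
  simp
  ring

lemma hasDerivAt_gaugeGrad1_line (w v : ℝ × ℝ × ℝ) :
    HasDerivAt (fun s : ℝ => gaugeGrad1 (w + s • v))
      (2 * (w.1 * v.1 + w.2.1 * v.2.1) * w.1 + hor w * v.1
        - 4 * (v.2.1 * w.2.2 + w.2.1 * v.2.2)) 0 := by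
  refine HasDerivAt.congr_deriv (((hasDerivAt_hor_line w v).fun_mul
    (hasDerivAt_fst_line w v)).fun_sub
    (((hasDerivAt_snd_fst_line w v).const_mul 4).fun_mul (hasDerivAt_snd_snd_line w v))) ?_
  simp
  ring

lemma hasDerivAt_gaugeGrad2_line (w v : ℝ × ℝ × ℝ) :
    HasDerivAt (fun s : ℝ => gaugeGrad2 (w + s • v))
      (2 * (w.1 * v.1 + w.2.1 * v.2.1) * w.2.1 + hor w * v.2.1
        + 4 * (v.1 * w.2.2 + w.1 * v.2.2)) 0 := by
  refine HasDerivAt.congr_deriv (((hasDerivAt_hor_line w v).fun_mul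
    (hasDerivAt_snd_fst_line w v)).fun_add
    (((hasDerivAt_fst_line w v).const_mul 4).fun_mul (hasDerivAt_snd_snd_line w v))) ?_
  simp
  ring

lemma hasDerivAt_regWeight_line (p q : ℝ) {ε : ℝ} (hε : 0 < ε) (w v : ℝ × ℝ × ℝ) :
    HasDerivAt (fun s : ℝ => regWeight p q ε (w + s • v))
      (regWeight p q ε w * ((q - 2) / 2 * (2 * w.1 * v.1 + 2 * w.2.1 * v.2.1) / (hor w + ε)
        - (q / 4 / (gauge4 w + ε) + p / 4 * (gauge4 w + ε) ^ (p / 4 - 1)) *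
          (4 * hor w * (w.1 * v.1 + w.2.1 * v.2.1) + 32 * w.2.2 * v.2.2))) 0 := by
  have h3 : 0 < hor w + ε := by have := hor_nonneg w; positivity
  have h4 : 0 < gauge4 w + ε := by have := gauge4_nonneg w; positivity
  have hR := (hasDerivAt_hor_line w v).add_const ε
  have hK := (hasDerivAt_gauge4_line w v).add_const ε
  have e : w + (0 : ℝ) • v = w := by simp
  refine HasDerivAt.congr_deriv
    (((hR.rpow_const (p := (q - 2) / 2) (Or.inl (e.symm ▸ h3.ne'))).fun_mul
    (hK.rpow_const (p := -q / 4) (Or.inl (e.symm ▸ h4.ne')))).fun_mul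
    (hK.rpow_const (p := p / 4) (Or.inl (e.symm ▸ h4.ne'))).fun_neg.exp) ?_
  rw [e, rpow_sub_one h3.ne' ((q - 2) / 2), rpow_sub_one h4.ne' (-q / 4), regWeight]
  field_simp
  ring

lemma X1_add_X2_regWeight (p q : ℝ) {ε : ℝ} (hε : 0 < ε) {g : ℝ × ℝ × ℝ → ℝ} {w : ℝ × ℝ × ℝ}
    (hg : DifferentiableAt ℝ g w) :
    X1 (fun w => regWeight p q ε w * gaugeGrad1 w * g w) w +
        X2 (fun w => regWeight p q ε w * gaugeGrad2 w * g w) w =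
      regWeight p q ε w * (gaugeGrad1 w * X1 g w + gaugeGrad2 w * X2 g w) +
      g w * regWeight p q ε w * (6 * hor w + (q - 2) * hor w ^ 2 / (hor w + ε)
        - q * hor w * gauge4 w / (gauge4 w + ε)
        - p * (gauge4 w + ε) ^ (p / 4 - 1) * (hor w * gauge4 w)) := by
  have dA : DifferentiableAt ℝ (regWeight p q ε) w :=
    (contDiff_regWeight (n := 1) p q hε).differentiable one_ne_zero w
  have d1 : DifferentiableAt ℝ gaugeGrad1 w :=
    (contDiff_gaugeGrad1 (n := 1)).differentiable one_ne_zero w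
  have d2 : DifferentiableAt ℝ gaugeGrad2 w :=
    (contDiff_gaugeGrad2 (n := 1)).differentiable one_ne_zero w
  have eA (v) := dA.fderiv_apply_eq_of_hasDerivAt (hasDerivAt_regWeight_line p q hε w v)
  have e1 (v) := d1.fderiv_apply_eq_of_hasDerivAt (hasDerivAt_gaugeGrad1_line w v)
  have e2 (v) := d2.fderiv_apply_eq_of_hasDerivAt (hasDerivAt_gaugeGrad2_line w v)
  unfold X1 X2
  rw [fderiv_fun_mul (dA.fun_mul d1) hg, fderiv_fun_mul (dA.fun_mul d2) hg,
    fderiv_fun_mul dA d1, fderiv_fun_mul dA d2]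
  simp only [add_apply, smul_apply, smul_eq_mul, eA, e1, e2]
  generalize regWeight p q ε w = A
  generalize (gauge4 w + ε) ^ (p / 4 - 1) = E
  generalize fderiv ℝ g w _ = a
  generalize fderiv ℝ g w _ = b
  simp only [div_eq_mul_inv (_ : ℝ) (gauge4 w + ε), div_eq_mul_inv (_ : ℝ) (hor w + ε)]
  generalize (gauge4 w + ε)⁻¹ = J
  generalize (hor w + ε)⁻¹ = I
  simp only [gauge4, gaugeGrad1, gaugeGrad2, hor]
  ring

lemma integral_fderiv_apply_eq_zero {E : Type*} [NormedAddCommGroup E] [NormedSpace ℝ E]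
    [FiniteDimensional ℝ E] [MeasurableSpace E] [BorelSpace E] (μ : Measure E) [μ.IsAddHaarMeasure]
    {h : E → ℝ} (hh : ContDiff ℝ 1 h) (hc : HasCompactSupport h) (v : E) :
    ∫ w, fderiv ℝ h w v ∂μ = 0 := by
  have hi : Integrable (fun w => fderiv ℝ h w v) μ :=
    ((hh.continuous_fderiv one_ne_zero).clm_apply continuous_const).integrable_of_hasCompactSupport
      (hc.fderiv_apply ℝ v)
  have := integral_mul_fderiv_eq_neg_fderiv_mul_of_integrable (μ := μ) (f := fun _ : E => (1 : ℝ))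
    (g := h) (v := v) (by simp) (by simpa using hi)
    (by simpa using hh.continuous.integrable_of_hasCompactSupport hc)
    (fun _ _ => differentiableAt_const _) (fun w _ => hh.differentiable one_ne_zero w)
  simpa using this

lemma continuous_X1 {h : ℝ × ℝ × ℝ → ℝ} (hh : ContDiff ℝ 1 h) : Continuous (X1 h) :=
  (hh.continuous_fderiv one_ne_zero).clm_apply (by fun_prop)

lemma continuous_X2 {h : ℝ × ℝ × ℝ → ℝ} (hh : ContDiff ℝ 1 h) : Continuous (X2 h) :=
  (hh.continuous_fderiv one_ne_zero).clm_apply (by fun_prop)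

lemma HasCompactSupport.X1 {h : ℝ × ℝ × ℝ → ℝ} (hc : HasCompactSupport h) :
    HasCompactSupport (X1 h) :=
  (hc.fderiv ℝ).mono fun w hw hw' => hw (by simp [_root_.X1, hw'])

lemma HasCompactSupport.X2 {h : ℝ × ℝ × ℝ → ℝ} (hc : HasCompactSupport h) :
    HasCompactSupport (X2 h) :=
  (hc.fderiv ℝ).mono fun w hw hw' => hw (by simp [_root_.X2, hw'])

instance isAddHaarMeasure_volume_prod_prod :
    (volume : Measure (ℝ × ℝ × ℝ)).IsAddHaarMeasure :=
  have : (volume : Measure (ℝ × ℝ)).IsAddHaarMeasure :=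
    inferInstanceAs ((volume : Measure ℝ).prod volume).IsAddHaarMeasure
  inferInstanceAs ((volume : Measure ℝ).prod (volume : Measure (ℝ × ℝ))).IsAddHaarMeasure

lemma integral_X1_eq_zero {h : ℝ × ℝ × ℝ → ℝ} (hh : ContDiff ℝ 1 h) (hc : HasCompactSupport h) :
    ∫ w, X1 h w = 0 := by
  have hh' : ContDiff ℝ 1 fun w : ℝ × ℝ × ℝ => -w.2.1 / 2 * h w := by fun_prop
  have hc' : HasCompactSupport fun w : ℝ × ℝ × ℝ => -w.2.1 / 2 * h w := hc.mul_left
  have key (w) : X1 h w = fderiv ℝ h w (1, 0, 0) +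
      fderiv ℝ (fun w : ℝ × ℝ × ℝ => -w.2.1 / 2 * h w) w (0, 0, 1) := by
    have hd := hh.differentiable one_ne_zero w
    have h0 : fderiv ℝ (fun w : ℝ × ℝ × ℝ => -w.2.1 / 2) w (0, 0, 1) = 0 :=
      DifferentiableAt.fderiv_apply_eq_of_hasDerivAt (by fun_prop) (by
        simpa using (hasDerivAt_snd_fst_line w (0, 0, 1)).fun_neg.div_const 2)
    rw [fderiv_fun_mul (by fun_prop) hd, add_apply, smul_apply, smul_apply, h0]
    rw [X1, show ((1 : ℝ), (0 : ℝ), -w.2.1 / 2) =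
      (1, 0, 0) + (-w.2.1 / 2) • ((0 : ℝ), (0 : ℝ), (1 : ℝ)) by
      simp, map_add, map_smul]
    simp
  simp_rw [key]
  rw [integral_add, integral_fderiv_apply_eq_zero _ hh hc, integral_fderiv_apply_eq_zero _ hh' hc',
    add_zero]
  · exact ((hh.continuous_fderiv one_ne_zero).clm_apply
      continuous_const).integrable_of_hasCompactSupport (hc.fderiv_apply ℝ _)
  · exact ((hh'.continuous_fderiv one_ne_zero).clm_apply
      continuous_const).integrable_of_hasCompactSupport (hc'.fderiv_apply ℝ _)

lemma integral_X2_eq_zero {h : ℝ × ℝ × ℝ → ℝ} (hh : ContDiff ℝ 1 h) (hc : HasCompactSupport h) :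
    ∫ w, X2 h w = 0 := by
  have hh' : ContDiff ℝ 1 fun w : ℝ × ℝ × ℝ => w.1 / 2 * h w := by fun_prop
  have hc' : HasCompactSupport fun w : ℝ × ℝ × ℝ => w.1 / 2 * h w := hc.mul_left
  have key (w) : X2 h w = fderiv ℝ h w (0, 1, 0) +
      fderiv ℝ (fun w : ℝ × ℝ × ℝ => w.1 / 2 * h w) w (0, 0, 1) := by
    have hd := hh.differentiable one_ne_zero w
    have h0 : fderiv ℝ (fun w : ℝ × ℝ × ℝ => w.1 / 2) w (0, 0, 1) = 0 :=
      DifferentiableAt.fderiv_apply_eq_of_hasDerivAt (by fun_prop) (by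
        simpa using (hasDerivAt_fst_line w (0, 0, 1)).div_const 2)
    rw [fderiv_fun_mul (by fun_prop) hd, add_apply, smul_apply, smul_apply, h0]
    rw [X2, show ((0 : ℝ), (1 : ℝ), w.1 / 2) =
      (0, 1, 0) + (w.1 / 2) • ((0 : ℝ), (0 : ℝ), (1 : ℝ)) by
      simp, map_add, map_smul]
    simp
  simp_rw [key]
  rw [integral_add, integral_fderiv_apply_eq_zero _ hh hc, integral_fderiv_apply_eq_zero _ hh' hc',
    add_zero]
  · exact ((hh.continuous_fderiv one_ne_zero).clm_apply
      continuous_const).integrable_of_hasCompactSupport (hc.fderiv_apply ℝ _)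
  · exact ((hh'.continuous_fderiv one_ne_zero).clm_apply
      continuous_const).integrable_of_hasCompactSupport (hc'.fderiv_apply ℝ _)

lemma fderiv_abs_rpow_apply {E : Type*} [NormedAddCommGroup E] [NormedSpace ℝ E] {f : E → ℝ} {w : E}
    (hf : DifferentiableAt ℝ f w) {q : ℝ} (hq : 1 < q) (v : E) :
    fderiv ℝ (fun w => |f w| ^ q) w v = q * |f w| ^ (q - 2) * f w * fderiv ℝ f w v := by
  have h := (hasDerivAt_abs_rpow (f w) hq).comp_hasFDerivAt w hf.hasFDerivAt
  rw [show (fun w => |f w| ^ q) = (fun x : ℝ => |x| ^ q) ∘ f from rfl, h.fderiv]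
  simp

lemma contDiff_abs_rpow {E : Type*} [NormedAddCommGroup E] [NormedSpace ℝ E] {f : E → ℝ}
    (hf : ContDiff ℝ 1 f) {q : ℝ} (hq : 1 < q) : ContDiff ℝ 1 fun w => |f w| ^ q :=
  (contDiff_norm_rpow (E := ℝ) hq).comp hf

lemma gaugeGrad_sq_add (w) : gaugeGrad1 w ^ 2 + gaugeGrad2 w ^ 2 = hor w * gauge4 w := by
  simp only [gaugeGrad1, gaugeGrad2, gauge4, hor]; ring

lemma rpow_mul_sqrt_le {p q P K ε : ℝ} (hp : 2 < p) (hpq : p * q = p + q) (hε : 0 < ε)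
    (hP : 0 ≤ P) (hK : 0 ≤ K) :
    ((P + ε) ^ ((q - 2) / 2) * (K + ε) ^ (-q / 4) * √(P * K)) ^ p ≤
      (P + ε) ^ ((q - 2) / 2) * (K + ε) ^ (-q / 4) * (K + ε) ^ (p / 4 - 1) * (P * K) := by
  have hR : 0 < P + ε := by positivity
  have hM : 0 < K + ε := by positivity
  have aux {a : ℝ} (ha : 0 ≤ a) : a ^ (p / 2) ≤ a * (a + ε) ^ (p / 2 - 1) := by
    rcases ha.eq_or_lt with rfl | ha
    · rw [zero_rpow (by linarith)]; simp
    · calc a ^ (p / 2) = a * a ^ (p / 2 - 1) := by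
            rw [← rpow_one_add' ha.le (by linarith)]; ring_nf
        _ ≤ _ := by
            gcongr
            · linarith
            · linarith
  calc _ = (P + ε) ^ ((q - 2) / 2 * p) * (K + ε) ^ (-q / 4 * p) *
        (P ^ (p / 2) * K ^ (p / 2)) := by
        rw [mul_rpow (by positivity) (by positivity), mul_rpow (by positivity) (by positivity),
          ← rpow_mul hR.le, ← rpow_mul hM.le, sqrt_eq_rpow, ← rpow_mul (by positivity),
          mul_rpow hP hK]
        ring_nf
    _ ≤ (P + ε) ^ ((q - 2) / 2 * p) * (K + ε) ^ (-q / 4 * p) *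
        ((P * (P + ε) ^ (p / 2 - 1)) * (K * (K + ε) ^ (p / 2 - 1))) := by
        gcongr <;> exact aux ‹_›
    _ = ((P + ε) ^ ((q - 2) / 2 * p) * (P + ε) ^ (p / 2 - 1)) *
        ((K + ε) ^ (-q / 4 * p) * (K + ε) ^ (p / 2 - 1)) * (P * K) := by ring
    _ = _ := by
        rw [← rpow_add hR, ← rpow_add hM, mul_assoc ((P + ε) ^ ((q - 2) / 2)), ← rpow_add hM]
        congr 3
        · linear_combination hpq / 2
        · linear_combination -hpq / 4

lemma hor_mul_rpow_le {q P K ε : ℝ} (hq0 : 0 < q) (hq : q < 2) (hε : 0 < ε) (hP : 0 ≤ P)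
    (hK : P ^ 2 ≤ K) : (P + ε) ^ ((q - 2) / 2) * (K + ε) ^ (-q / 4) * P ≤ 1 := by
  rcases hP.eq_or_lt with rfl | hP
  · simp
  have hM : P ^ 2 ≤ K + ε := by linarith
  have hM0 : 0 < K + ε := (pow_pos hP 2).trans_le hM
  calc _ ≤ P ^ ((q - 2) / 2) * (P ^ 2) ^ (-q / 4) * P := by
        refine mul_le_mul_of_nonneg_right (mul_le_mul ?_ ?_ (by positivity) (by positivity)) hP.le
        · exact rpow_le_rpow_of_nonpos hP (by linarith) (by linarith)
        · exact rpow_le_rpow_of_nonpos (by positivity) hM (by linarith)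
    _ = 1 := by
        rw [← rpow_natCast, ← rpow_mul hP.le, ← rpow_add hP, ← rpow_add_one hP.ne']
        convert rpow_zero P using 2
        push_cast
        ring

lemma abs_gaugeGrad_dot_le (a b w) :
    |gaugeGrad1 w * a + gaugeGrad2 w * b| ≤ √(hor w * gauge4 w) * √(a ^ 2 + b ^ 2) := by
  rw [← gaugeGrad_sq_add, ← sqrt_mul (by positivity)]
  refine abs_le_sqrt ?_
  nlinarith [sq_nonneg (gaugeGrad1 w * b - gaugeGrad2 w * a)]

/-- Regularisation of `|x|^q N^{p-q} e^{-N^p}`. -/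
noncomputable def lhsReg (p q ε : ℝ) (w : ℝ × ℝ × ℝ) : ℝ :=
  regWeight p q ε w * ((gauge4 w + ε) ^ (p / 4 - 1) * (hor w * gauge4 w))

lemma lhsReg_mul_le {p q ε : ℝ} (hp : 2 < p) (hq1 : 1 < q) (hq2 : q < 2) (hpq : p * q = p + q)
    (hε : 0 < ε) {f : ℝ × ℝ × ℝ → ℝ} {w : ℝ × ℝ × ℝ} (hf : DifferentiableAt ℝ f w)
    (hg : DifferentiableAt ℝ (fun w => |f w| ^ q) w) :
    lhsReg p q ε w * |f w| ^ q ≤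
      exp (-gauge4 w ^ (p / 4)) * (((X1 f w) ^ 2 + (X2 f w) ^ 2) ^ (q / 2) + 6 * |f w| ^ q) -
      (X1 (fun w => regWeight p q ε w * gaugeGrad1 w * |f w| ^ q) w +
        X2 (fun w => regWeight p q ε w * gaugeGrad2 w * |f w| ^ q) w) := by
  have hP := hor_nonneg w
  have hK := gauge4_nonneg w
  have hPK : hor w ^ 2 ≤ gauge4 w := by unfold gauge4; nlinarith [sq_nonneg w.2.2]
  have hR : 0 < hor w + ε := by positivity
  have hM : 0 < gauge4 w + ε := by positivity
  rw [X1_add_X2_regWeight p q hε hg]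
  have e1 : X1 (fun w => |f w| ^ q) w = q * |f w| ^ (q - 2) * f w * X1 f w :=
    fderiv_abs_rpow_apply hf hq1 _
  have e2 : X2 (fun w => |f w| ^ q) w = q * |f w| ^ (q - 2) * f w * X2 f w :=
    fderiv_abs_rpow_apply hf hq1 _
  rw [e1, e2]
  have hT := rpow_mul_sqrt_le hp hpq hε hP hK
  have hB := hor_mul_rpow_le (by linarith) hq2 hε hP hPK
  have hdot := abs_gaugeGrad_dot_le (X1 f w) (X2 f w) w
  have hW : exp (-(gauge4 w + ε) ^ (p / 4)) ≤ exp (-gauge4 w ^ (p / 4)) := by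
    gcongr
    linarith
  unfold lhsReg regWeight
  set B := (hor w + ε) ^ ((q - 2) / 2) * (gauge4 w + ε) ^ (-q / 4) with hBdef
  set W := exp (-(gauge4 w + ε) ^ (p / 4))
  set E := (gauge4 w + ε) ^ (p / 4 - 1)
  have hB0 : 0 ≤ B := by positivity
  have hW0 : 0 < W := exp_pos _
  have hE0 : 0 ≤ E := by positivity
  set D := (X1 f w) ^ 2 + (X2 f w) ^ 2
  have hD : 0 ≤ D := by positivity
  have hg0 : 0 ≤ |f w| ^ q := by positivity
  have hy := young_inequality_of_nonneg (a := B * √(hor w * gauge4 w) * |f w| ^ (q - 1)) (b := √D)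
    (p := p) (q := q) (by positivity) (by positivity)
    ⟨by field_simp; linarith, by linarith, by linarith⟩
  have hDq : √D ^ q = D ^ (q / 2) := by
    rw [sqrt_eq_rpow, ← rpow_mul hD]; ring_nf
  have hfp : (|f w| ^ (q - 1)) ^ p = |f w| ^ q := by
    rw [← rpow_mul (abs_nonneg _)]; congr 1; linarith
  rw [hDq, mul_rpow (by positivity) (by positivity), hfp] at hy
  have hfq : |f w| ^ (q - 2) * |f w| = |f w| ^ (q - 1) := by
    rcases eq_or_ne (f w) 0 with h | h
    · rw [h, abs_zero, zero_rpow (by linarith : q - 1 ≠ 0)]; simp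
    · rw [← rpow_add_one (abs_ne_zero.2 h)]; ring_nf
  set T := B * E * (hor w * gauge4 w) with hTdef
  have hT0 : 0 ≤ T := by positivity
  have hcross : -(B * (gaugeGrad1 w * (q * |f w| ^ (q - 2) * f w * X1 f w)
      + gaugeGrad2 w * (q * |f w| ^ (q - 2) * f w * X2 f w))) ≥
      -(q * (B * √(hor w * gauge4 w) * |f w| ^ (q - 1) * √D)) := by
    rw [ge_iff_le, neg_le_neg_iff]
    have : |f w| ^ (q - 2) * f w * (gaugeGrad1 w * X1 f w + gaugeGrad2 w * X2 f w) ≤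
        |f w| ^ (q - 1) * (√(hor w * gauge4 w) * √D) := by
      refine (le_abs_self _).trans ?_
      rw [abs_mul, abs_mul, abs_of_nonneg (by positivity : 0 ≤ |f w| ^ (q - 2)), hfq]
      gcongr
    have := mul_le_mul_of_nonneg_left this (by positivity : 0 ≤ q * B)
    linarith
  have hy' : q * (B * √(hor w * gauge4 w) * |f w| ^ (q - 1) * √D) ≤
      T * |f w| ^ q + D ^ (q / 2) := by
    have h1 : (B * √(hor w * gauge4 w)) ^ p * |f w| ^ q ≤ T * |f w| ^ q := by gcongr
    have h2 := mul_le_mul_of_nonneg_left hy (by linarith : 0 ≤ q)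
    have h3 : q * ((B * √(hor w * gauge4 w)) ^ p * |f w| ^ q / p + D ^ (q / 2) / q) =
        q / p * ((B * √(hor w * gauge4 w)) ^ p * |f w| ^ q) + D ^ (q / 2) := by field_simp
    have h4 : q / p ≤ 1 := (div_le_one (by linarith)).2 (by linarith)
    have h5 : q / p * ((B * √(hor w * gauge4 w)) ^ p * |f w| ^ q) ≤ 1 * (T * |f w| ^ q) := by
      gcongr
    linarith
  have hbr : B * (6 * hor w + (q - 2) * hor w ^ 2 / (hor w + ε)
        - q * hor w * gauge4 w / (gauge4 w + ε)) ≤ 6 := by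
    have h1 : (q - 2) * hor w ^ 2 / (hor w + ε) ≤ 0 :=
      div_nonpos_of_nonpos_of_nonneg
        (mul_nonpos_of_nonpos_of_nonneg (by linarith) (by positivity)) hR.le
    have h2 : 0 ≤ q * hor w * gauge4 w / (gauge4 w + ε) := by positivity
    have h3 := mul_le_mul_of_nonneg_left (by linarith : 6 * hor w + (q - 2) * hor w ^ 2 / (hor w + ε)
        - q * hor w * gauge4 w / (gauge4 w + ε) ≤ 6 * hor w) hB0
    linarith
  have h1 : W * (D ^ (q / 2) + 6 * |f w| ^ q) ≤
      exp (-gauge4 w ^ (p / 4)) * (D ^ (q / 2) + 6 * |f w| ^ q) := by gcongr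
  have h2 := mul_le_mul_of_nonneg_left hbr hg0
  have h3 : 0 ≤ (p - 2) * (T * |f w| ^ q) := mul_nonneg (by linarith) (by positivity)
  have h4 : T * |f w| ^ q ≤ D ^ (q / 2) + 6 * |f w| ^ q
      - (B * (gaugeGrad1 w * (q * |f w| ^ (q - 2) * f w * X1 f w)
      + gaugeGrad2 w * (q * |f w| ^ (q - 2) * f w * X2 f w)) +
      |f w| ^ q * (B * (6 * hor w + (q - 2) * hor w ^ 2 / (hor w + ε)
        - q * hor w * gauge4 w / (gauge4 w + ε))) - p * (T * |f w| ^ q)) := by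
    linarith
  have h5 := mul_le_mul_of_nonneg_left h4 hW0.le
  refine le_trans (le_of_eq ?_) (h5.trans (le_of_eq_of_le ?_ (sub_le_sub_right h1 _)))
  · rw [hTdef]; ring
  · rw [hTdef]; ring

lemma continuous_lhsReg {p q ε : ℝ} (hε : 0 < ε) : Continuous (lhsReg p q ε) := by
  have cK := (contDiff_gauge4 (n := 1)).continuous
  have : Continuous fun w => (gauge4 w + ε) ^ (p / 4 - 1) :=
    (cK.add continuous_const).rpow_const fun w =>
      Or.inl (add_pos_of_nonneg_of_pos (gauge4_nonneg w) hε).ne'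
  exact (contDiff_regWeight (n := 1) p q hε).continuous.mul
    (this.mul ((contDiff_hor (n := 1)).continuous.mul cK))

lemma continuous_exp_neg_gauge4_rpow {r : ℝ} (hr : 0 ≤ r) :
    Continuous fun w => exp (-gauge4 w ^ r) :=
  ((contDiff_gauge4 (n := 1)).continuous.rpow_const fun _ => Or.inr hr).neg.rexp

lemma continuous_subgradient_rpow {r : ℝ} (hr : 0 ≤ r) {f : ℝ × ℝ × ℝ → ℝ} (hf : ContDiff ℝ 1 f) :
    Continuous fun w => ((X1 f w) ^ 2 + (X2 f w) ^ 2) ^ r :=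
  (((continuous_X1 hf).pow 2).add ((continuous_X2 hf).pow 2)).rpow_const fun _ => Or.inr hr

lemma HasCompactSupport.subgradient_rpow {r : ℝ} (hr : r ≠ 0) {f : ℝ × ℝ × ℝ → ℝ}
    (hc : HasCompactSupport f) :
    HasCompactSupport fun w => ((_root_.X1 f w) ^ 2 + (_root_.X2 f w) ^ 2) ^ r :=
  hc.X1.comp₂_left hc.X2 (m := fun a b : ℝ => (a ^ 2 + b ^ 2) ^ r) (by simp [zero_rpow hr])

lemma HasCompactSupport.abs_rpow {E : Type*} [TopologicalSpace E] {r : ℝ} (hr : r ≠ 0) {f : E → ℝ}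
    (hc : HasCompactSupport f) : HasCompactSupport fun w => |f w| ^ r :=
  hc.comp_left (g := fun x : ℝ => |x| ^ r) (by simp [zero_rpow hr])

lemma integral_lhsReg_mul_le {p q ε : ℝ} (hp : 2 < p) (hq1 : 1 < q) (hq2 : q < 2)
    (hpq : p * q = p + q) (hε : 0 < ε) {f : ℝ × ℝ × ℝ → ℝ} (hf : ContDiff ℝ 1 f)
    (hc : HasCompactSupport f) :
    ∫ w, lhsReg p q ε w * |f w| ^ q ≤
      ∫ w, exp (-gauge4 w ^ (p / 4)) *
        (((X1 f w) ^ 2 + (X2 f w) ^ 2) ^ (q / 2) + 6 * |f w| ^ q) := by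
  have hg := contDiff_abs_rpow hf hq1
  have hgc := hc.abs_rpow (by linarith : q ≠ 0)
  have hreg := contDiff_regWeight (n := 1) p q hε
  have hD1 : ContDiff ℝ 1 fun w => regWeight p q ε w * gaugeGrad1 w * |f w| ^ q :=
    (hreg.mul contDiff_gaugeGrad1).mul hg
  have hD2 : ContDiff ℝ 1 fun w => regWeight p q ε w * gaugeGrad2 w * |f w| ^ q :=
    (hreg.mul contDiff_gaugeGrad2).mul hg
  have hDc1 : HasCompactSupport fun w => regWeight p q ε w * gaugeGrad1 w * |f w| ^ q := hgc.mul_left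
  have hDc2 : HasCompactSupport fun w => regWeight p q ε w * gaugeGrad2 w * |f w| ^ q := hgc.mul_left
  have i1 := (continuous_X1 hD1).integrable_of_hasCompactSupport hDc1.X1 (μ := volume)
  have i2 := (continuous_X2 hD2).integrable_of_hasCompactSupport hDc2.X2 (μ := volume)
  have i3 : Integrable fun w => lhsReg p q ε w * |f w| ^ q :=
    ((continuous_lhsReg hε).mul hg.continuous).integrable_of_hasCompactSupport hgc.mul_left
  have i4 : Integrable fun w => exp (-gauge4 w ^ (p / 4)) *
        (((X1 f w) ^ 2 + (X2 f w) ^ 2) ^ (q / 2) + 6 * |f w| ^ q) :=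
    Continuous.integrable_of_hasCompactSupport
      ((continuous_exp_neg_gauge4_rpow (by linarith)).mul
        ((continuous_subgradient_rpow (by linarith) hf).add (continuous_const.mul hg.continuous)))
      ((hc.subgradient_rpow (by linarith)).add hgc.mul_left).mul_left
  calc _ ≤ ∫ w, (exp (-gauge4 w ^ (p / 4)) *
          (((X1 f w) ^ 2 + (X2 f w) ^ 2) ^ (q / 2) + 6 * |f w| ^ q) -
        (X1 (fun w => regWeight p q ε w * gaugeGrad1 w * |f w| ^ q) w +
          X2 (fun w => regWeight p q ε w * gaugeGrad2 w * |f w| ^ q) w)) :=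
        integral_mono i3 (i4.sub (i1.add i2)) fun w =>
          lhsReg_mul_le hp hq1 hq2 hpq hε (hf.differentiable one_ne_zero w)
            (hg.differentiable one_ne_zero w)
    _ = _ := by
        rw [integral_sub i4 (by exact i1.add i2), integral_add i1 i2, integral_X1_eq_zero hD1 hDc1,
          integral_X2_eq_zero hD2 hDc2]
        simp

open Filter Topology in
lemma tendsto_lhsReg {p q : ℝ} (hq0 : 0 < q) (w : ℝ × ℝ × ℝ) :
    Tendsto (fun ε => lhsReg p q ε w) (𝓝[>] 0)
      (𝓝 (exp (-gauge4 w ^ (p / 4)) * (hor w ^ (q / 2) * gauge4 w ^ ((p - q) / 4)))) := by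
  rcases (hor_nonneg w).eq_or_lt with h | hP
  · simp [lhsReg, ← h, zero_rpow (by linarith : q / 2 ≠ 0)]
  have hK : 0 < gauge4 w := by unfold gauge4; positivity
  have hR : Tendsto (fun ε => hor w + ε) (𝓝[>] 0) (𝓝 (hor w)) := by
    simpa using
      ((tendsto_id (α := ℝ) (x := 𝓝 0)).mono_left nhdsWithin_le_nhds).const_add (hor w)
  have hM : Tendsto (fun ε => gauge4 w + ε) (𝓝[>] 0) (𝓝 (gauge4 w)) := by
    simpa using
      ((tendsto_id (α := ℝ) (x := 𝓝 0)).mono_left nhdsWithin_le_nhds).const_add (gauge4 w)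
  have key := (((hR.rpow_const (p := (q - 2) / 2) (Or.inl hP.ne')).mul
    (hM.rpow_const (p := -q / 4) (Or.inl hK.ne'))).mul
    (hM.rpow_const (p := p / 4) (Or.inl hK.ne')).neg.rexp).mul
    ((hM.rpow_const (p := p / 4 - 1) (Or.inl hK.ne')).mul_const (hor w * gauge4 w))
  have h1 : hor w ^ (q / 2) = hor w ^ ((q - 2) / 2) * hor w := by
    rw [← rpow_add_one hP.ne']; ring_nf
  have h2 : gauge4 w ^ ((p - q) / 4) =
      gauge4 w ^ (-q / 4) * gauge4 w ^ (p / 4 - 1) * gauge4 w := by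
    rw [← rpow_add hK, ← rpow_add_one hK.ne']; ring_nf
  rw [h1, h2]
  convert! key using 2
  ring

lemma lhsReg_le {p q ε : ℝ} (hq : q < 2) (hqp : q < p) (hε : 0 < ε) (hε1 : ε ≤ 1)
    (w : ℝ × ℝ × ℝ) : lhsReg p q ε w ≤ hor w ^ (q / 2) * (gauge4 w + 1) ^ ((p - q) / 4) := by
  have hK := gauge4_nonneg w
  have hM : 0 < gauge4 w + ε := by positivity
  rcases (hor_nonneg w).eq_or_lt with h | hP
  · simp only [lhsReg, ← h, zero_mul, mul_zero]
    positivity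
  have h1 : (hor w + ε) ^ ((q - 2) / 2) * hor w ≤ hor w ^ (q / 2) := by
    calc _ ≤ hor w ^ ((q - 2) / 2) * hor w := by
          refine mul_le_mul_of_nonneg_right ?_ hP.le
          exact rpow_le_rpow_of_nonpos hP (by linarith) (by linarith)
      _ = _ := by rw [← rpow_add_one hP.ne']; ring_nf
  have h2 : (gauge4 w + ε) ^ (-q / 4) * (gauge4 w + ε) ^ (p / 4 - 1) * gauge4 w ≤
      (gauge4 w + 1) ^ ((p - q) / 4) := by
    calc _ ≤ (gauge4 w + ε) ^ (-q / 4) * (gauge4 w + ε) ^ (p / 4 - 1) * (gauge4 w + ε) := by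
          gcongr
          linarith
      _ = (gauge4 w + ε) ^ ((p - q) / 4) := by
          rw [← rpow_add hM, ← rpow_add_one hM.ne']; ring_nf
      _ ≤ _ := by gcongr
  have h3 : exp (-(gauge4 w + ε) ^ (p / 4)) ≤ 1 := by
    rw [exp_le_one_iff, neg_nonpos]; positivity
  calc lhsReg p q ε w = ((hor w + ε) ^ ((q - 2) / 2) * hor w) *
        ((gauge4 w + ε) ^ (-q / 4) * (gauge4 w + ε) ^ (p / 4 - 1) * gauge4 w) *
        exp (-(gauge4 w + ε) ^ (p / 4)) := by unfold lhsReg regWeight; ring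
    _ ≤ hor w ^ (q / 2) * (gauge4 w + 1) ^ ((p - q) / 4) * 1 := by gcongr
    _ = _ := mul_one _

lemma lhsReg_nonneg {p q ε : ℝ} (hε : 0 < ε) (w : ℝ × ℝ × ℝ) : 0 ≤ lhsReg p q ε w := by
  have hP := hor_nonneg w
  have hK := gauge4_nonneg w
  unfold lhsReg regWeight
  positivity

open Filter Topology in
lemma integral_weight_mul_le {p q : ℝ} (hp : 2 < p) (hq1 : 1 < q) (hq2 : q < 2)
    (hpq : p * q = p + q) {f : ℝ × ℝ × ℝ → ℝ} (hf : ContDiff ℝ 1 f) (hc : HasCompactSupport f) :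
    ∫ w, exp (-gauge4 w ^ (p / 4)) * (hor w ^ (q / 2) * gauge4 w ^ ((p - q) / 4)) * |f w| ^ q ≤
      ∫ w, exp (-gauge4 w ^ (p / 4)) *
        (((X1 f w) ^ 2 + (X2 f w) ^ 2) ^ (q / 2) + 6 * |f w| ^ q) := by
  have hg := (contDiff_abs_rpow hf hq1).continuous
  have hgc := hc.abs_rpow (by linarith : q ≠ 0)
  have hε : ∀ᶠ ε : ℝ in 𝓝[>] 0, 0 < ε ∧ ε ≤ 1 :=
    (eventually_mem_nhdsWithin).and
      (eventually_nhdsWithin_of_eventually_nhds (eventually_le_nhds one_pos))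
  refine le_of_tendsto (tendsto_integral_filter_of_dominated_convergence
    (F := fun ε w => lhsReg p q ε w * |f w| ^ q)
    (fun w => hor w ^ (q / 2) * (gauge4 w + 1) ^ ((p - q) / 4) * |f w| ^ q) ?_ ?_ ?_ ?_)
    (hε.mono fun ε h => integral_lhsReg_mul_le hp hq1 hq2 hpq h.1 hf hc)
  · exact hε.mono fun ε h => ((continuous_lhsReg h.1).mul hg).aestronglyMeasurable
  · refine hε.mono fun ε h => ae_of_all _ fun w => ?_
    rw [norm_of_nonneg (mul_nonneg (lhsReg_nonneg h.1 w) (by positivity))]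
    exact mul_le_mul_of_nonneg_right (lhsReg_le hq2 (by linarith) h.1 h.2 w) (by positivity)
  · refine Continuous.integrable_of_hasCompactSupport ?_ hgc.mul_left
    have h1 : Continuous fun w => hor w ^ (q / 2) :=
      (contDiff_hor (n := 1)).continuous.rpow_const fun w => Or.inr (by linarith)
    have h2 : Continuous fun w => (gauge4 w + 1) ^ ((p - q) / 4) :=
      ((contDiff_gauge4 (n := 1)).continuous.add continuous_const).rpow_const
        fun w => Or.inr (by linarith)
    exact (h1.mul h2).mul hg
  · exact ae_of_all _ fun w => (tendsto_lhsReg (by linarith) w).mul_const _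

lemma KaplanH_rpow (r : ℝ) (w : ℝ × ℝ × ℝ) : KaplanH w ^ r = gauge4 w ^ (r / 4) := by
  have : KaplanH w = gauge4 w ^ ((1 : ℝ) / 4) := rfl
  rw [this, ← rpow_mul (gauge4_nonneg w)]
  ring_nf

lemma integral_muH {p : ℝ} (hp : 0 ≤ p) (h : ℝ × ℝ × ℝ → ℝ) :
    ∫ w, h w ∂(muH p) = (∫ v : ℝ × ℝ × ℝ, exp (-(KaplanH v) ^ p))⁻¹ *
      ∫ w, exp (-gauge4 w ^ (p / 4)) * h w := by
  have hZ : 0 ≤ (∫ v : ℝ × ℝ × ℝ, exp (-(KaplanH v) ^ p))⁻¹ :=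
    inv_nonneg.2 (integral_nonneg fun _ => (exp_pos _).le)
  have hm : Measurable fun w => ENNReal.ofReal
      ((∫ v : ℝ × ℝ × ℝ, exp (-(KaplanH v) ^ p))⁻¹ * exp (-(KaplanH w) ^ p)) := by
    simp_rw [KaplanH_rpow]
    exact (continuous_const.mul
      (continuous_exp_neg_gauge4_rpow (by linarith))).measurable.ennreal_ofReal
  rw [muH, integral_withDensity_eq_integral_toReal_smul hm (by simp), ← integral_const_mul]
  congr with w
  rw [ENNReal.toReal_ofReal (mul_nonneg hZ (exp_pos _).le), smul_eq_mul, mul_assoc, KaplanH_rpow]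

/-- `U`-bound in `L^q` on the Heisenberg group for `dμ = Z⁻¹ e^{-N^p} dξ`, `p > 2`,
`q = p/(p-1)`: `∫ |x|^q N^{p-q} |f|^q dμ ≤ C(∫ |∇_ℍ f|^q dμ + ∫ |f|^q dμ)`. -/
theorem ubound_Lq_heisenberg (p q : ℝ) (hp : 2 < p) (hq : q = p / (p - 1)) :
    ∃ C > 0, ∀ f : ℝ × ℝ × ℝ → ℝ, ContDiff ℝ (⊤ : ℕ∞) f → HasCompactSupport f →
      ∫ w, (w.1 ^ 2 + w.2.1 ^ 2) ^ (q / 2) * (KaplanH w) ^ (p - q) * |f w| ^ q ∂(muH p) ≤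
        C * ((∫ w, ((X1 f w) ^ 2 + (X2 f w) ^ 2) ^ (q / 2) ∂(muH p)) +
             (∫ w, |f w| ^ q ∂(muH p))) := by
  have hp1 : 0 < p - 1 := by linarith
  have hq1 : 1 < q := by rw [hq, lt_div_iff₀ hp1]; linarith
  have hq2 : q < 2 := by rw [hq, div_lt_iff₀ hp1]; linarith
  have hpq : p * q = p + q := by rw [hq]; field_simp; ring
  refine ⟨6, by norm_num, fun f hf hc => ?_⟩
  have hf1 : ContDiff ℝ 1 f := hf.of_le (by exact_mod_cast le_top)
  have hg := (contDiff_abs_rpow hf1 hq1).continuous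
  have hgc := hc.abs_rpow (by linarith : q ≠ 0)
  have hW := continuous_exp_neg_gauge4_rpow (by linarith : 0 ≤ p / 4)
  have hD := continuous_subgradient_rpow (by linarith : 0 ≤ q / 2) hf1
  have hDc := hc.subgradient_rpow (by linarith : q / 2 ≠ 0)
  have iD := (hW.fun_mul hD).integrable_of_hasCompactSupport hDc.mul_left (μ := volume)
  have ig := (hW.fun_mul hg).integrable_of_hasCompactSupport hgc.mul_left (μ := volume)
  have iD0 : 0 ≤ ∫ w, exp (-gauge4 w ^ (p / 4)) * ((X1 f w) ^ 2 + (X2 f w) ^ 2) ^ (q / 2) :=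
    integral_nonneg fun w => by positivity
  have main := integral_weight_mul_le hp hq1 hq2 hpq hf1 hc
  simp_rw [mul_add, mul_left_comm _ (6 : ℝ)] at main
  rw [integral_add iD (ig.const_mul 6), integral_const_mul] at main
  simp_rw [integral_muH (by linarith : 0 ≤ p), KaplanH_rpow]
  rw [← mul_add, mul_left_comm]
  refine mul_le_mul_of_nonneg_left ?_ (inv_nonneg.2 (integral_nonneg fun _ => (exp_pos _).le))
  calc _ = _ := by simp_rw [mul_assoc]; rfl
    _ ≤ _ := main
    _ ≤ _ := by linarith
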